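/- Failure of mean continuity in variable exponent Lebesgue spaces: if B ⊂ ℝ^N is an open ball and p : B → ℝ is continuous, nonconstant, and satisfies 1 < inf_B p ≤ sup_B p < ∞, then there exists a measurable function u : ℝ^N → ℝ vanishing outside B with ∫_B |u(x)|^{p(x)} dx < ∞ such that for every ε > 0 there exists h ∈ ℝ^N with 0 < |h| < ε and ∫_{B} |u(x + h)|^{p(x)} dx = ∞. -/

import Mathlib

open MeasureTheory

/-- A function that is integrable on sets of finite volume, but none of whose powers larger
than `1` is integrable in any neighbourhood of `y`. -/
lemma exists_integrable_rpow_not_integrable {N : ℕ} (hN : 0 < N) (y : Fin N → ℝ) :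
    ∃ g : (Fin N → ℝ) → ℝ, Measurable g ∧ (∀ x, 1 ≤ g x) ∧
      (∀ s : Set (Fin N → ℝ), volume s < ⊤ → ∫⁻ x in s, ENNReal.ofReal (g x) < ⊤) ∧
      ∀ q > (1 : ℝ), ∀ δ > (0 : ℝ),
        ∫⁻ x in Metric.ball y δ, ENNReal.ofReal (g x ^ q) = ⊤ := by
  set s : ℕ → ℝ := fun n => (1 / 2) ^ (n ^ 2 + n) with hs
  have s_pos : ∀ n, 0 < s n := fun n => by positivity
  have s_le : ∀ n, s n ≤ 1 := fun n => pow_le_one₀ (by norm_num) (by norm_num)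
  set c : ℕ → ℝ := fun n => (1 / 2) ^ n / s n ^ N with hc
  have c_pos : ∀ n, 0 < c n := fun n => div_pos (by positivity) (pow_pos (s_pos n) N)
  have c_mul : ∀ n, c n * s n ^ N = (1 / 2) ^ n := fun n =>
    div_mul_cancel₀ _ (pow_pos (s_pos n) N).ne'
  have c_ge : ∀ n, (2 : ℝ) ^ (n ^ 2) ≤ c n := fun n => by
    rw [hc, le_div_iff₀ (pow_pos (s_pos n) N)]
    calc (2 : ℝ) ^ (n ^ 2) * s n ^ N ≤ 2 ^ (n ^ 2) * s n := by
          gcongr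
          exact pow_le_of_le_one (s_pos n).le (s_le n) hN.ne'
      _ = (1 / 2) ^ n := by
          rw [hs]
          simp only [pow_add]
          rw [← mul_assoc, ← mul_pow]
          norm_num
  have vol : ∀ n, volume (Metric.ball y (s n / 2)) = ENNReal.ofReal (s n ^ N) := fun n => by
    rw [Real.volume_pi_ball y (half_pos (s_pos n)), Fintype.card_fin]
    congr 2
    ring
  set G : (Fin N → ℝ) → ENNReal := fun x =>
    ∑' n, (Metric.ball y (s n / 2)).indicator (fun _ => ENNReal.ofReal (c n)) x with hG
  have G_meas : Measurable G := Measurable.tsum fun n =>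
    measurable_const.indicator Metric.isOpen_ball.measurableSet
  have G_int : ∫⁻ x, G x ≠ ⊤ := by
    rw [hG, lintegral_tsum fun n =>
      (measurable_const.indicator Metric.isOpen_ball.measurableSet).aemeasurable]
    have : ∀ n, ∫⁻ x, (Metric.ball y (s n / 2)).indicator
        (fun _ => ENNReal.ofReal (c n)) x = ENNReal.ofReal ((1 / 2) ^ n) := fun n => by
      rw [lintegral_indicator_const Metric.isOpen_ball.measurableSet, vol,
        ← ENNReal.ofReal_mul (c_pos n).le, c_mul]
    simp_rw [this]
    rw [← ENNReal.ofReal_tsum_of_nonneg (fun n => by positivity) summable_geometric_two]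
    exact ENNReal.ofReal_ne_top
  refine ⟨fun x => 1 + (G x).toReal, by fun_prop, fun x => by simp, ?_, ?_⟩
  · intro t ht
    calc ∫⁻ x in t, ENNReal.ofReal (1 + (G x).toReal)
        ≤ ∫⁻ x in t, (1 + G x) := by
          refine lintegral_mono fun x => ?_
          rw [ENNReal.ofReal_add zero_le_one ENNReal.toReal_nonneg, ENNReal.ofReal_one]
          gcongr
          exact ENNReal.ofReal_toReal_le
      _ = volume t + ∫⁻ x in t, G x := by
          rw [lintegral_add_left measurable_const, setLIntegral_one]
      _ < ⊤ := ENNReal.add_lt_top.2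
          ⟨ht, (setLIntegral_le_lintegral t G).trans_lt (lt_top_iff_ne_top.2 G_int)⟩
  · intro q hq δ hδ
    have fin : ∀ᵐ x, G x < ⊤ := ae_lt_top G_meas G_int
    obtain ⟨k, hk⟩ := exists_nat_gt (2 / (q - 1))
    obtain ⟨l, hl⟩ := exists_pow_lt_of_lt_one hδ (by norm_num : (1 / 2 : ℝ) < 1)
    have key : ∀ n ≥ max k l,
        (n : ENNReal) ≤ ∫⁻ x in Metric.ball y δ, ENNReal.ofReal ((1 + (G x).toReal) ^ q) := by
      intro n hn
      have hkn : (k : ℝ) ≤ n := by exact_mod_cast (le_max_left k l).trans hn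
      have hsub : Metric.ball y (s n / 2) ⊆ Metric.ball y δ := by
        refine Metric.ball_subset_ball ?_
        have : s n ≤ (1 / 2) ^ l := pow_le_pow_of_le_one (by norm_num) (by norm_num)
          (((le_max_right k l).trans hn).trans (Nat.le_add_left _ _))
        linarith [s_pos n]
      have hq2 : 2 ≤ (q - 1) * n := by
        have h1 : 2 < k * (q - 1) := (div_lt_iff₀ (by linarith)).1 hk
        nlinarith
      have real_bound : (n : ℝ) ≤ c n ^ q * s n ^ N := by
        have h1 : c n ^ q = c n ^ (q - 1) * c n := by
          rw [← Real.rpow_add_one (c_pos n).ne', sub_add_cancel]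
        have h2 : (4 : ℝ) ^ n ≤ c n ^ (q - 1) := by
          calc (4 : ℝ) ^ n = 2 ^ ((2 : ℝ) * n) := by
                rw [Real.rpow_mul (by norm_num), Real.rpow_natCast]; norm_num
            _ ≤ 2 ^ ((n ^ 2 : ℕ) * (q - 1)) := by
                apply Real.rpow_le_rpow_of_exponent_le (by norm_num)
                push_cast
                nlinarith [Nat.cast_nonneg (α := ℝ) n]
            _ = ((2 : ℝ) ^ (n ^ 2)) ^ (q - 1) := by
                rw [Real.rpow_mul (by norm_num), Real.rpow_natCast]
            _ ≤ c n ^ (q - 1) :=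
                Real.rpow_le_rpow (by positivity) (c_ge n) (by linarith)
        rw [h1, mul_assoc, c_mul]
        calc (n : ℝ) ≤ 2 ^ n := by exact_mod_cast Nat.lt_two_pow_self.le
          _ = 4 ^ n * (1 / 2) ^ n := by rw [← mul_pow]; norm_num
          _ ≤ _ := by gcongr
      calc (n : ENNReal) = ENNReal.ofReal n := (ENNReal.ofReal_natCast n).symm
        _ ≤ ENNReal.ofReal (c n ^ q * s n ^ N) := ENNReal.ofReal_le_ofReal real_bound
        _ = ∫⁻ _ in Metric.ball y (s n / 2), ENNReal.ofReal (c n ^ q) := by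
            rw [setLIntegral_const, vol, ENNReal.ofReal_mul (by have := c_pos n; positivity)]
        _ ≤ ∫⁻ x in Metric.ball y (s n / 2), ENNReal.ofReal ((1 + (G x).toReal) ^ q) := by
            refine setLIntegral_mono_ae' Metric.isOpen_ball.measurableSet ?_
            filter_upwards [fin] with x hx hxb
            refine ENNReal.ofReal_le_ofReal
              (Real.rpow_le_rpow (c_pos n).le ?_ (by linarith))
            have : ENNReal.ofReal (c n) ≤ G x := by
              have h := ENNReal.le_tsum (f := fun n => (Metric.ball y (s n / 2)).indicator
                (fun _ => ENNReal.ofReal (c n)) x) n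
              rwa [Set.indicator_of_mem hxb] at h
            linarith [(ENNReal.ofReal_le_iff_le_toReal hx.ne).1 this]
        _ ≤ _ := lintegral_mono_set hsub
    by_contra hne
    obtain ⟨n, hn⟩ := ENNReal.exists_nat_gt hne
    have h1 := key (max n (max k l)) (le_max_right _ _)
    have h2 : (n : ENNReal) ≤ (max n (max k l) : ℕ) := by exact_mod_cast le_max_left _ _
    exact absurd hn (not_lt.2 (h2.trans h1))

/-- A nonconstant continuous function on a preconnected open set takes larger values arbitrarily
close to some point. -/
lemma exists_forall_exists_dist_lt_lt {X : Type*} [PseudoMetricSpace X] {B : Set X}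
    (hBo : IsOpen B) (hBc : IsPreconnected B) {p : X → ℝ} (hpc : ContinuousOn p B)
    (hpnc : ∃ x ∈ B, ∃ y ∈ B, p x ≠ p y) :
    ∃ y ∈ B, ∀ ε > 0, ∃ z ∈ B, dist z y < ε ∧ p y < p z := by
  by_contra! hcon
  obtain ⟨a, ha, b, hb, hab⟩ : ∃ a ∈ B, ∃ b ∈ B, p a < p b := by
    obtain ⟨x, hx, y, hy, hxy⟩ := hpnc
    rcases hxy.lt_or_gt with h | h
    · exact ⟨x, hx, y, hy, h⟩
    · exact ⟨y, hy, x, hx, h⟩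
  have open_le : IsOpen (B ∩ {x | p x ≤ p a}) := by
    rw [Metric.isOpen_iff]
    rintro x ⟨hx, hxa⟩
    obtain ⟨ε, hε, h⟩ := hcon x hx
    obtain ⟨ε', hε', h'⟩ := Metric.isOpen_iff.1 hBo x hx
    refine ⟨min ε ε', lt_min hε hε', fun z hz => ?_⟩
    have hzB : z ∈ B := h' (Metric.ball_subset_ball (min_le_right _ _) hz)
    exact ⟨hzB, (h z hzB (hz.trans_le (min_le_left _ _))).trans hxa⟩
  have open_gt : IsOpen (B ∩ p ⁻¹' Set.Ioi (p a)) := hpc.isOpen_inter_preimage hBo isOpen_Ioi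
  obtain ⟨x, -, ⟨-, h1⟩, -, h2⟩ := hBc _ _ open_le open_gt
    (fun x hx => (le_or_gt (p x) (p a)).imp (fun h => ⟨hx, h⟩) fun h => ⟨hx, h⟩)
    ⟨a, ha, ha, le_refl (p a)⟩ ⟨b, hb, hb, hab⟩
  rw [Set.mem_ofPred] at h1
  exact h1.not_gt h2

/-- Failure of mean continuity in variable exponent Lebesgue spaces. -/
theorem variable_exponent_mean_continuity_fails {N : ℕ}
    (x₀ : Fin N → ℝ) (r : ℝ) (hr : 0 < r)
    (B : Set (Fin N → ℝ)) (hB : B = Metric.ball x₀ r)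
    (p : (Fin N → ℝ) → ℝ) (hpc : ContinuousOn p B)
    (hpnc : ∃ x ∈ B, ∃ y ∈ B, p x ≠ p y)
    (m M : ℝ) (hm : 1 < m) (hpb : ∀ x ∈ B, m ≤ p x ∧ p x ≤ M) :
    ∃ u : (Fin N → ℝ) → ℝ, Measurable u ∧ (∀ x, x ∉ B → u x = 0) ∧
      (∫⁻ x in B, ENNReal.ofReal (|u x| ^ p x)) < ⊤ ∧
      ∀ ε > (0 : ℝ), ∃ h : Fin N → ℝ, 0 < ‖h‖ ∧ ‖h‖ < ε ∧
        (∫⁻ x in B, ENNReal.ofReal (|u (x + h)| ^ p x)) = ⊤ := by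
  have hN : 0 < N := by
    rcases Nat.eq_zero_or_pos N with rfl | h
    · obtain ⟨x, -, y, -, hxy⟩ := hpnc
      exact absurd (congrArg p (Subsingleton.elim x y)) hxy
    · exact h
  have hBo : IsOpen B := hB ▸ Metric.isOpen_ball
  have hBm : MeasurableSet B := hBo.measurableSet
  have hBc : IsPreconnected B := hB ▸ (convex_ball x₀ r).isPreconnected
  have hBv : volume B < ⊤ := hB ▸ measure_ball_lt_top
  obtain ⟨y, hy, hyz⟩ := exists_forall_exists_dist_lt_lt hBo hBc hpc hpnc
  obtain ⟨g, g_meas, one_le_g, g_int, g_top⟩ := exists_integrable_rpow_not_integrable hN y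
  have p_pos : ∀ x ∈ B, 0 < p x := fun x hx => by linarith [(hpb x hx).1]
  have p_meas : Measurable (B.indicator p) := by
    classical
    rw [← Set.piecewise_eq_indicator]
    exact hpc.measurable_piecewise continuousOn_const hBm
  set u : (Fin N → ℝ) → ℝ := B.indicator fun x => g x ^ (B.indicator p x)⁻¹ with hu
  have u_abs : ∀ x ∈ B, |u x| = g x ^ (p x)⁻¹ := fun x hx => by
    rw [hu, Set.indicator_of_mem hx, Set.indicator_of_mem hx,
      abs_of_nonneg (Real.rpow_nonneg (zero_le_one.trans (one_le_g x)) _)]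
  refine ⟨u, (g_meas.pow p_meas.inv).indicator hBm, fun x hx => Set.indicator_of_notMem hx _,
    ?_, fun ε hε => ?_⟩
  · rw [setLIntegral_congr_fun hBm (g := fun x => ENNReal.ofReal (g x))]
    · exact g_int B hBv
    · intro x hx
      simp only
      rw [u_abs x hx, Real.rpow_inv_rpow (zero_le_one.trans (one_le_g x)) (p_pos x hx).ne']
  obtain ⟨z, hz, hzy, hlt⟩ := hyz ε hε
  obtain ⟨c₁, h1, h1z⟩ := exists_between hlt
  obtain ⟨c₂, h12, h2⟩ := exists_between h1z
  have c₁_pos : 0 < c₁ := (p_pos y hy).trans h1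
  obtain ⟨δ₁, hδ₁, hy_ball⟩ := Metric.isOpen_iff.1
    (hpc.isOpen_inter_preimage hBo isOpen_Iio) y ⟨hy, h1⟩
  obtain ⟨δ₂, hδ₂, hz_ball⟩ := Metric.isOpen_iff.1
    (hpc.isOpen_inter_preimage hBo isOpen_Ioi) z ⟨hz, h2⟩
  set δ := min δ₁ δ₂ with hδ
  refine ⟨y - z, norm_pos_iff.2 (sub_ne_zero.2 ?_), by rwa [← dist_eq_norm, dist_comm],
    top_unique ?_⟩
  · rintro rfl
    exact lt_irrefl _ hlt
  have pre : (fun x => x + (y - z)) ⁻¹' Metric.ball y δ = Metric.ball z δ := by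
    ext x
    simp only [Set.mem_preimage, Metric.mem_ball, dist_eq_norm]
    rw [show x + (y - z) - y = x - z by abel]
  calc ⊤ = ∫⁻ x in Metric.ball y δ, ENNReal.ofReal (g x ^ (c₂ / c₁)) :=
        (g_top _ ((one_lt_div c₁_pos).2 h12) δ (lt_min hδ₁ hδ₂)).symm
    _ = ∫⁻ x in Metric.ball z δ, ENNReal.ofReal (g (x + (y - z)) ^ (c₂ / c₁)) := by
        rw [← pre]
        exact ((measurePreserving_add_right volume (y - z)).setLIntegral_comp_preimage_emb
          (measurableEmbedding_addRight _) _ _).symm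
    _ ≤ ∫⁻ x in Metric.ball z δ, ENNReal.ofReal (|u (x + (y - z))| ^ p x) := by
        refine setLIntegral_mono' Metric.isOpen_ball.measurableSet fun x hx => ?_
        have hx2 := hz_ball (Metric.ball_subset_ball (min_le_right _ _) hx)
        rw [← pre] at hx
        have hx1 := hy_ball (Metric.ball_subset_ball (min_le_left _ _) hx)
        refine ENNReal.ofReal_le_ofReal ?_
        rw [u_abs _ hx1.1, ← Real.rpow_mul (zero_le_one.trans (one_le_g _))]
        refine Real.rpow_le_rpow_of_exponent_le (one_le_g _) ?_
        rw [inv_mul_eq_div]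
        exact div_le_div₀ (p_pos x hx2.1).le (le_of_lt hx2.2) (p_pos _ hx1.1) (le_of_lt hx1.2)
    _ ≤ _ := lintegral_mono_set fun x hx =>
        (hz_ball (Metric.ball_subset_ball (min_le_right _ _) hx)).1
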